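/- Let S be a finitely generated, separative, commutative semigroup without idempotents all of whose endomorphisms are power functions (for every endomorphism f there is a positive integer n with f(x) = x^n for all x). Then S is isomorphic to a subsemigroup of the infinite monogenic semigroup, i.e., there is an injective map f : S → ℕ⁺ into the additive semigroup of positive integers with f(xy) = f(x) + f(y). -/

import Mathlib

/-- `spow x n` is the `(n+1)`-st power `x^(n+1)` of `x` in a semigroup. -/
def spow {S : Type*} [Semigroup S] (x : S) : ℕ → S
  | 0 => x
  | n + 1 => spow x n * x

open Algebra

/-- In a finitely generated abelian group, an element either has a nonzero multiple in a given
subgroup or is detected by an integral functional vanishing on that subgroup. -/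
theorem exists_smul_mem_or_exists_dual_ne_zero {V : Type*} [AddCommGroup V] [Module.Finite ℤ V]
    (H : Submodule ℤ V) (x : V) :
    (∃ m : ℤ, m ≠ 0 ∧ m • x ∈ H) ∨ ∃ f : V →ₗ[ℤ] ℤ, (∀ h ∈ H, f h = 0) ∧ f x ≠ 0 := by
  by_cases hx : H.mkQ x ∈ Submodule.torsion ℤ (V ⧸ H)
  · left
    obtain ⟨m, hm⟩ := hx
    refine ⟨m, nonZeroDivisors.coe_ne_zero m, ?_⟩
    rw [← Submodule.Quotient.mk_eq_zero]
    exact hm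
  · right
    have hne : (Submodule.torsion ℤ (V ⧸ H)).mkQ (H.mkQ x) ≠ 0 := by
      rwa [Submodule.mkQ_apply, Ne, Submodule.Quotient.mk_eq_zero]
    rw [Ne, ← Module.forall_dual_apply_eq_zero_iff ℤ, not_forall] at hne
    obtain ⟨f, hf⟩ := hne
    refine ⟨f ∘ₗ (Submodule.torsion ℤ (V ⧸ H)).mkQ ∘ₗ H.mkQ, fun h hh => ?_, hf⟩
    have : H.mkQ h = 0 := by simpa using hh
    simp only [LinearMap.comp_apply, this, map_zero]

/-- An integral form of Gordan's theorem of the alternative. -/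
theorem exists_dual_nonneg_or_exists_pos_sum_eq_zero {V ι : Type*} [AddCommGroup V]
    [Module.Finite ℤ V] (s : Finset ι) (g : ι → V) :
    (∃ f : V →ₗ[ℤ] ℤ, (∀ i ∈ s, 0 ≤ f (g i)) ∧ ∃ i ∈ s, 0 < f (g i)) ∨
      ∃ v : ι → ℤ, (∀ i ∈ s, 0 < v i) ∧ ∑ i ∈ s, v i • g i = 0 := by
  classical
  induction s using Finset.induction_on generalizing g with
  | empty => right; exact ⟨0, by simp, by simp⟩
  | insert a s ha ih =>
    have key : ∀ (v : ι → ℤ) (c : ℤ), (∀ i ∈ s, 0 < v i) → 0 < c →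
        c • g a + ∑ i ∈ s, v i • g i = 0 →
        ∃ v : ι → ℤ, (∀ i ∈ insert a s, 0 < v i) ∧ ∑ i ∈ insert a s, v i • g i = 0 := by
      intro v c hv hc h
      have hne : ∀ i ∈ s, i ≠ a := fun i hi h => ha (h ▸ hi)
      refine ⟨Function.update v a c, ?_, ?_⟩
      · intro i hi
        rcases Finset.mem_insert.1 hi with rfl | hi
        · simpa using hc
        · simpa [Function.update_of_ne (hne i hi)] using hv i hi
      · rw [Finset.sum_insert ha, Function.update_self, ← h]
        congr 1
        exact Finset.sum_congr rfl fun i hi => by rw [Function.update_of_ne (hne i hi)]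
    rcases ih g with ⟨f, hf, j, hj, hfj⟩ | ⟨w, hw, hw0⟩
    · rcases le_or_gt 0 (f (g a)) with hfa | hfa
      · left
        refine ⟨f, ?_, j, Finset.mem_insert_of_mem hj, hfj⟩
        intro i hi
        rcases Finset.mem_insert.1 hi with rfl | hi
        exacts [hfa, hf i hi]
      · let p : V →ₗ[ℤ] V := (-f (g a)) • LinearMap.id + f.smulRight (g a)
        have hp : ∀ x, p x = (-f (g a)) • x + f x • g a := fun x => by simp [p]
        rcases ih (fun i => p (g i)) with ⟨f', hf', j', hj', hfj'⟩ | ⟨v, hv, hv0⟩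
        · left
          refine ⟨f' ∘ₗ p, ?_, j', Finset.mem_insert_of_mem hj', hfj'⟩
          intro i hi
          rcases Finset.mem_insert.1 hi with rfl | hi
          · rw [LinearMap.comp_apply, hp]; simp
          · exact hf' i hi
        · right
          refine key (fun i => v i * -f (g a)) (∑ i ∈ s, v i * f (g i)) ?_ ?_ ?_
          · intro i hi
            exact mul_pos (hv i hi) (by linarith)
          · exact Finset.sum_pos' (fun i hi => mul_nonneg (hv i hi).le (hf i hi))
              ⟨j, hj, mul_pos (hv j hj) hfj⟩
          · rw [← hv0, Finset.sum_smul, ← Finset.sum_add_distrib]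
            refine Finset.sum_congr rfl fun i _ => ?_
            rw [hp, smul_add, smul_smul, smul_smul, add_comm]
    · rcases exists_smul_mem_or_exists_dual_ne_zero (Submodule.span ℤ (g '' s)) (g a) with
        ⟨m, hm, hmem⟩ | ⟨f, hf, hfa⟩
      · right
        obtain ⟨b, hb⟩ : ∃ b : ι → ℤ, ∑ i ∈ s, b i • g i = |m| • g a := by
          have hmem' : |m| • g a ∈ Submodule.span ℤ (g '' s) := by
            rcases abs_choice m with h | h <;> rw [h]
            · exact hmem
            · rw [neg_smul]; exact neg_mem hmem
          exact Submodule.mem_span_image_finset_iff_exists_fun' ℤ |>.1 hmem'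
        refine key (fun i => (∑ j ∈ s, |b j| + 1) * w i - b i) |m| ?_ (abs_pos.2 hm) ?_
        · intro i hi
          have h1 : |b i| ≤ ∑ j ∈ s, |b j| :=
            Finset.single_le_sum (f := fun j => |b j|) (fun j _ => abs_nonneg _) hi
          have h2 := le_abs_self (b i)
          have h3 := hw i hi
          have h4 := abs_nonneg (b i)
          nlinarith
        · simp only [sub_smul, mul_smul, Finset.sum_sub_distrib, ← Finset.smul_sum, hw0, hb]
          simp
      · left
        have hf0 : ∀ i ∈ s, f (g i) = 0 := fun i hi =>
          hf _ (Submodule.subset_span ⟨i, hi, rfl⟩)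
        rcases lt_or_gt_of_ne hfa with h | h
        · refine ⟨-f, ?_, a, Finset.mem_insert_self _ _, by simpa using h⟩
          intro i hi
          rcases Finset.mem_insert.1 hi with rfl | hi
          · simpa using h.le
          · simp [hf0 i hi]
        · refine ⟨f, ?_, a, Finset.mem_insert_self _ _, h⟩
          intro i hi
          rcases Finset.mem_insert.1 hi with rfl | hi
          · exact h.le
          · simp [hf0 i hi]

theorem WithOne.coe_spow {S : Type*} [CommSemigroup S] (x : S) (n : ℕ) :
    ((spow x n : S) : WithOne S) = (x : WithOne S) ^ (n + 1) := by
  induction n with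
  | zero => simp [spow]
  | succ n ih => rw [spow, WithOne.coe_mul, ih, pow_succ _ (n + 1)]

theorem WithOne.coe_mul_ne_one {S : Type*} [CommSemigroup S] (x : S) (y : WithOne S) :
    (x : WithOne S) * y ≠ 1 := by
  refine WithOne.cases_on y ?_ fun y => ?_
  · simp
  · rw [← WithOne.coe_mul]; exact WithOne.coe_ne_one

theorem WithOne.eq_one_of_mul_self_eq {S : Type*} [CommSemigroup S] (hni : ∀ e : S, e * e ≠ e)
    {e : WithOne S} (he : e * e = e) : e = 1 := by
  by_contra h
  obtain ⟨x, rfl⟩ := WithOne.ne_one_iff_exists.1 h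
  exact hni x (WithOne.coe_inj.1 he)

theorem WithOne.eq_zero_of_pow_succ_eq_coe {S : Type*} [CommSemigroup S]
    (hni : ∀ e : S, e * e ≠ e) {x : S} {n : ℕ} (h : (x : WithOne S) ^ (n + 1) = x) : n = 0 := by
  cases n with
  | zero => rfl
  | succ k =>
    have hid : (x : WithOne S) ^ (k + 1) * (x : WithOne S) ^ (k + 1) = (x : WithOne S) ^ (k + 1) := by
      calc (x : WithOne S) ^ (k + 1) * (x : WithOne S) ^ (k + 1)
          = (x : WithOne S) ^ k * (x : WithOne S) ^ (k + 1 + 1) := by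
            rw [← pow_add, ← pow_add]; congr 1; omega
        _ = (x : WithOne S) ^ (k + 1) := by rw [h, pow_succ]
    have := WithOne.eq_one_of_mul_self_eq hni hid
    rw [pow_succ'] at this
    exact absurd this (WithOne.coe_mul_ne_one _ _)

theorem WithOne.closure_image_coe_eq_top {S : Type*} [CommSemigroup S] {F : Set S}
    (hF : Subsemigroup.closure F = ⊤) :
    Submonoid.closure ((fun x : S => (x : WithOne S)) '' F) = ⊤ := by
  refine eq_top_iff.2 fun m _ => ?_
  refine WithOne.cases_on m (one_mem _) fun x => ?_
  · have hx : x ∈ Subsemigroup.closure F := hF ▸ Subsemigroup.mem_top x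
    induction hx using Subsemigroup.closure_induction with
    | mem x hx => exact Submonoid.subset_closure ⟨x, hx, rfl⟩
    | mul x y _ _ hx hy =>
      rw [WithOne.coe_mul]
      exact mul_mem hx hy

/-- A nonempty finitely generated commutative semigroup without idempotents has a nonzero
homomorphism to the additive monoid of natural numbers. -/
theorem exists_nat_valued_hom_ne_zero {S : Type*} [CommSemigroup S] [Nonempty S]
    (hfg : ∃ F : Finset S, Subsemigroup.closure (F : Set S) = ⊤) (hni : ∀ e : S, e * e ≠ e) :
    ∃ φ : S → ℕ, (∀ x y : S, φ (x * y) = φ x + φ y) ∧ ∃ x, 0 < φ x := by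
  classical
  obtain ⟨F, hF⟩ := hfg
  have hcl := WithOne.closure_image_coe_eq_top hF
  have hMfg : Monoid.FG (WithOne S) :=
    Monoid.fg_iff.2 ⟨_, hcl, (Finset.finite_toSet F).image _⟩
  have hV : Module.Finite ℤ (Additive (GrothendieckGroup (WithOne S))) := by
    rw [Module.Finite.iff_addGroup_fg, AddGroup.fg_iff_addMonoid_fg]
    infer_instance
  have hFne : F.Nonempty := by
    rw [Finset.nonempty_iff_ne_empty]
    rintro rfl
    obtain ⟨x⟩ := ‹Nonempty S›
    have hx : x ∈ Subsemigroup.closure ((∅ : Finset S) : Set S) := hF ▸ Subsemigroup.mem_top x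
    rw [Finset.coe_empty, Subsemigroup.closure_empty] at hx
    exact Subsemigroup.notMem_bot hx
  let γ : S → Additive (GrothendieckGroup (WithOne S)) := fun x =>
    Additive.ofMul (GrothendieckGroup.of (x : WithOne S))
  have hγ : ∀ x y, γ (x * y) = γ x + γ y := fun x y => by
    simp only [γ, WithOne.coe_mul, map_mul, ofMul_mul]
  rcases exists_dual_nonneg_or_exists_pos_sum_eq_zero F γ with
    ⟨f, hf, i, _, hfi⟩ | ⟨v, hv, hv0⟩
  · have hnn : ∀ x, 0 ≤ f (γ x) := by
      intro x
      have hx : x ∈ Subsemigroup.closure (F : Set S) := hF ▸ Subsemigroup.mem_top x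
      induction hx using Subsemigroup.closure_induction with
      | mem x hx => exact hf x hx
      | mul x y _ _ hx hy => rw [hγ, map_add]; exact add_nonneg hx hy
    refine ⟨fun x => (f (γ x)).toNat, fun x y => ?_, i, by simpa using hfi⟩
    simp only [hγ, map_add]
    rw [Int.toNat_add (hnn x) (hnn y)]
  · exfalso
    let A : WithOne S := ∏ i ∈ F, (i : WithOne S) ^ (v i).toNat
    have hA : GrothendieckGroup.of A = GrothendieckGroup.of 1 := by
      apply Additive.ofMul.injective
      rw [map_one, ofMul_one, ← hv0, map_prod, ofMul_prod]
      refine Finset.sum_congr rfl fun i hi => ?_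
      rw [map_pow, ofMul_pow, ← natCast_zsmul, Int.toNat_of_nonneg (hv i hi).le]
    obtain ⟨c, hc⟩ := (Localization.monoidOf (⊤ : Submonoid (WithOne S))).exists_of_eq hA
    have hdvd : ∀ i ∈ F, (i : WithOne S) ∣ A := fun i hi =>
      (dvd_pow_self _ (by have := hv i hi; omega)).trans
        (Finset.dvd_prod_of_mem (fun i : S => (i : WithOne S) ^ (v i).toNat) hi)
    have hdiv : ∀ m : WithOne S, ∃ n, m ∣ A ^ n := by
      intro m
      have hm : m ∈ Submonoid.closure ((fun x : S => (x : WithOne S)) '' F) :=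
        hcl ▸ Submonoid.mem_top m
      induction hm using Submonoid.closure_induction with
      | mem m hm =>
        obtain ⟨i, hi, rfl⟩ := hm
        exact ⟨1, by simpa using hdvd i hi⟩
      | one => exact ⟨0, one_dvd _⟩
      | mul x y _ _ hx hy =>
        obtain ⟨a, ha⟩ := hx
        obtain ⟨b, hb⟩ := hy
        exact ⟨a + b, pow_add A a b ▸ mul_dvd_mul ha hb⟩
    obtain ⟨N, u, hu⟩ := hdiv c
    have hstep : A ^ N * A = A ^ N := by
      rw [hu, mul_right_comm, hc, mul_one]
    have hpow : ∀ k, A ^ N * A ^ k = A ^ N := by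
      intro k
      induction k with
      | zero => simp
      | succ k ih => rw [pow_succ, ← mul_assoc, ih, hstep]
    have hone : A ^ N = 1 := WithOne.eq_one_of_mul_self_eq hni (hpow N)
    rw [hone, one_mul] at hstep
    obtain ⟨i, hi⟩ := hFne
    obtain ⟨w, hw⟩ := hdvd i hi
    exact WithOne.coe_mul_ne_one i w (hw ▸ hstep)

/-- Multiplying `x` by the `φ x`-th power of a fixed element is an endomorphism. -/
theorem exists_forall_mul_pow_eq_pow {S : Type*} [CommSemigroup S]
    (hpow : ∀ f : S → S, (∀ x y : S, f (x * y) = f x * f y) →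
      ∃ n : ℕ, ∀ x : S, f x = spow x n)
    {φ : S → ℕ} (hφ : ∀ x y : S, φ (x * y) = φ x + φ y) (z : S) :
    ∃ n : ℕ, ∀ x : S, (x : WithOne S) * (z : WithOne S) ^ φ x = (x : WithOne S) ^ (n + 1) := by
  have hex : ∀ x : S, ∃ y : S, (y : WithOne S) = (x : WithOne S) * (z : WithOne S) ^ φ x :=
    fun x => WithOne.ne_one_iff_exists.1 (WithOne.coe_mul_ne_one _ _)
  choose f hf using hex
  obtain ⟨n, hn⟩ := hpow f fun x y => by
    rw [← WithOne.coe_inj, WithOne.coe_mul, hf, hf, hf, hφ, pow_add, WithOne.coe_mul,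
      mul_mul_mul_comm]
  exact ⟨n, fun x => by rw [← hf, hn, WithOne.coe_spow]⟩

theorem nat_valued_hom_pos {S : Type*} [CommSemigroup S] (hni : ∀ e : S, e * e ≠ e)
    (hpow : ∀ f : S → S, (∀ x y : S, f (x * y) = f x * f y) →
      ∃ n : ℕ, ∀ x : S, f x = spow x n)
    {φ : S → ℕ} (hφ : ∀ x y : S, φ (x * y) = φ x + φ y) (hne : ∃ x, 0 < φ x) (x : S) :
    0 < φ x := by
  by_contra hx
  obtain ⟨y, hy⟩ := hne
  obtain ⟨n, hn⟩ := exists_forall_mul_pow_eq_pow hpow hφ y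
  have hx0 : φ x = 0 := by omega
  have h0 : n = 0 := by
    refine WithOne.eq_zero_of_pow_succ_eq_coe hni (x := x) ?_
    rw [← hn, hx0, pow_zero, mul_one]
  have hy' := hn y
  rw [h0, zero_add, pow_one, ← pow_succ'] at hy'
  exact hy.ne' (WithOne.eq_zero_of_pow_succ_eq_coe hni hy')

theorem WithOne.eq_of_mul_self_eq_mul {S : Type*} [CommSemigroup S]
    (hsep : ∀ a b : S, a * a = a * b → b * b = a * b → a = b) {a b : WithOne S}
    (h₁ : a * a = a * b) (h₂ : b * b = a * b) : a = b := by
  by_cases ha : a = 1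
  · subst ha; simpa using h₁
  by_cases hb : b = 1
  · subst hb; simpa using h₂.symm
  obtain ⟨x, rfl⟩ := WithOne.ne_one_iff_exists.1 ha
  obtain ⟨y, rfl⟩ := WithOne.ne_one_iff_exists.1 hb
  exact congrArg _ (hsep x y (WithOne.coe_inj.1 h₁) (WithOne.coe_inj.1 h₂))

/-- In a separative commutative monoid, `x` and `y` agree as soon as they become equal after
multiplication by some power of `x`, and after multiplication by some power of `y`. -/
theorem eq_of_pow_mul_eq_pow_mul {M : Type*} [CommMonoid M]
    (hsep : ∀ a b : M, a * a = a * b → b * b = a * b → a = b) {x y : M} {m n : ℕ}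
    (hx : x ^ m * x = x ^ m * y) (hy : y ^ n * x = y ^ n * y) : x = y := by
  have key : ∀ T i j : ℕ, m + n ≤ i + j + T → x ^ (i + 1) * y ^ j = x ^ i * y ^ (j + 1) := by
    intro T
    induction T with
    | zero =>
      intro i j hij
      rcases le_or_gt m i with h | h
      · obtain ⟨k, rfl⟩ := Nat.exists_eq_add_of_le h
        calc x ^ (m + k + 1) * y ^ j = x ^ m * x * (x ^ k * y ^ j) := by
              simp only [pow_add, pow_one]; ac_rfl
          _ = x ^ (m + k) * y ^ (j + 1) := by
              rw [hx]; simp only [pow_add, pow_one]; ac_rfl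
      · obtain ⟨k, rfl⟩ := Nat.exists_eq_add_of_le (show n ≤ j by omega)
        calc x ^ (i + 1) * y ^ (n + k) = y ^ n * x * (x ^ i * y ^ k) := by
              simp only [pow_add, pow_one]; ac_rfl
          _ = x ^ i * y ^ (n + k + 1) := by
              rw [hy]; simp only [pow_add, pow_one]; ac_rfl
    | succ T ih =>
      intro i j hij
      have h₁ := ih (i + 1 + i) (j + j) (by omega)
      have h₂ := ih (i + i) (j + 1 + j) (by omega)
      refine hsep _ _ ?_ ?_
      · calc x ^ (i + 1) * y ^ j * (x ^ (i + 1) * y ^ j)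
            = x ^ (i + 1 + i + 1) * y ^ (j + j) := by simp only [pow_add, pow_one]; ac_rfl
          _ = x ^ (i + 1) * y ^ j * (x ^ i * y ^ (j + 1)) := by
            rw [h₁]; simp only [pow_add, pow_one]; ac_rfl
      · calc x ^ i * y ^ (j + 1) * (x ^ i * y ^ (j + 1))
            = x ^ (i + i) * y ^ (j + 1 + j + 1) := by simp only [pow_add, pow_one]; ac_rfl
          _ = x ^ (i + 1) * y ^ j * (x ^ i * y ^ (j + 1)) := by
            rw [← h₂]; simp only [pow_add, pow_one]; ac_rfl
  simpa using key (m + n) 0 0 (by omega)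

/-- A family of natural numbers, not all zero, is a multiple of a family generating `ℤ`. -/
theorem exists_eq_mul_and_closure_eq_top {S : Type*} (φ : S → ℕ) (hne : ∃ x, 0 < φ x) :
    ∃ (d : ℕ) (ψ : S → ℕ), 0 < d ∧ (∀ x, φ x = d * ψ x) ∧
      AddSubgroup.closure (Set.range fun x => (ψ x : ℤ)) = ⊤ := by
  obtain ⟨e, he⟩ := Int.subgroup_cyclic (AddSubgroup.closure (Set.range fun x => (φ x : ℤ)))
  have hmem : ∀ x, e.natAbs ∣ φ x := by
    intro x
    have hx : (φ x : ℤ) ∈ AddSubgroup.closure {e} :=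
      he ▸ AddSubgroup.subset_closure ⟨x, rfl⟩
    obtain ⟨k, hk⟩ := AddSubgroup.mem_closure_singleton.1 hx
    exact Int.natAbs_dvd_natAbs.2 (Dvd.intro_left k hk)
  choose ψ hψ using hmem
  have hd : 0 < e.natAbs := by
    obtain ⟨x, hx⟩ := hne
    rw [hψ] at hx
    exact Nat.pos_of_mul_pos_right hx
  refine ⟨e.natAbs, ψ, hd, hψ, ?_⟩
  have hmul : ∀ k ∈ AddSubgroup.closure (Set.range fun x => (φ x : ℤ)),
      ∃ l ∈ AddSubgroup.closure (Set.range fun x => (ψ x : ℤ)), k = e.natAbs * l := by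
    intro k hk
    induction hk using AddSubgroup.closure_induction with
    | mem k hk =>
      obtain ⟨x, rfl⟩ := hk
      exact ⟨ψ x, AddSubgroup.subset_closure ⟨x, rfl⟩, by simp only [hψ x]; push_cast; rfl⟩
    | zero => exact ⟨0, zero_mem _, by simp⟩
    | add k l _ _ hk hl =>
      obtain ⟨k', hk', rfl⟩ := hk
      obtain ⟨l', hl', rfl⟩ := hl
      exact ⟨k' + l', add_mem hk' hl', by ring⟩
    | neg k _ hk =>
      obtain ⟨k', hk', rfl⟩ := hk
      exact ⟨-k', neg_mem hk', by ring⟩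
  have hd_mem : (e.natAbs : ℤ) ∈ AddSubgroup.closure (Set.range fun x => (φ x : ℤ)) := by
    have hee : e ∈ AddSubgroup.closure (Set.range fun x => (φ x : ℤ)) :=
      he ▸ AddSubgroup.subset_closure rfl
    rcases Int.natAbs_eq e with h | h
    · exact h ▸ hee
    · have := neg_mem hee
      rw [h, neg_neg] at this
      simpa using this
  obtain ⟨l, hl, hle⟩ := hmul _ hd_mem
  have hl1 : l = 1 := by
    have hd' : (e.natAbs : ℤ) ≠ 0 := by exact_mod_cast hd.ne'
    exact (mul_right_eq_self₀.1 hle.symm).resolve_right hd'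
  subst hl1
  refine eq_top_iff.2 fun k _ => ?_
  simpa using zsmul_mem hl k

/-- **Borisov.** A finitely generated separative commutative semigroup without
idempotents, all of whose endomorphisms are power functions, is isomorphic to
a subsemigroup of the infinite monogenic semigroup (the additive semigroup of
positive integers). -/
theorem fg_separative_lesokhin_embeds_in_pnat {S : Type*} [CommSemigroup S]
    (hfg : ∃ F : Finset S, Subsemigroup.closure (F : Set S) = ⊤)
    (hsep : ∀ a b : S, a * a = a * b → b * b = a * b → a = b)
    (hni : ∀ e : S, e * e ≠ e)
    (hpow : ∀ f : S → S, (∀ x y : S, f (x * y) = f x * f y) →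
      ∃ n : ℕ, ∀ x : S, f x = spow x n) :
    ∃ f : S → ℕ+, Function.Injective f ∧ ∀ x y : S, f (x * y) = f x + f y := by
  rcases isEmpty_or_nonempty S with hS | hS
  · exact ⟨isEmptyElim, fun x => isEmptyElim x, fun x => isEmptyElim x⟩
  obtain ⟨φ, hφ, hne⟩ := exists_nat_valued_hom_ne_zero hfg hni
  obtain ⟨d, ψ, hd, hφψ, hψtop⟩ := exists_eq_mul_and_closure_eq_top φ hne
  have hψ : ∀ x y, ψ (x * y) = ψ x + ψ y := fun x y =>
    Nat.eq_of_mul_eq_mul_left hd (by rw [mul_add, ← hφψ, ← hφψ, ← hφψ, hφ])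
  have hψne : ∃ x, 0 < ψ x := by
    obtain ⟨x, hx⟩ := hne
    rw [hφψ] at hx
    exact ⟨x, Nat.pos_of_mul_pos_left hx⟩
  have hψpos := nat_valued_hom_pos hni hpow hψ hψne
  have hψspow : ∀ x n, ψ (spow x n) = (n + 1) * ψ x := by
    intro x n
    induction n with
    | zero => simp [spow]
    | succ n ih => rw [spow, hψ, ih]; ring
  have hcomm : ∀ x z : S,
      (x : WithOne S) * (z : WithOne S) ^ ψ x = (x : WithOne S) ^ (ψ z + 1) := by
    intro x z
    obtain ⟨n, hn⟩ := exists_forall_mul_pow_eq_pow hpow hψ z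
    obtain ⟨k, hk⟩ : ∃ k, ψ x = k + 1 := ⟨ψ x - 1, by have := hψpos x; omega⟩
    have h : x * spow z k = spow x n := by
      rw [← WithOne.coe_inj, WithOne.coe_mul, WithOne.coe_spow, WithOne.coe_spow, ← hk, hn]
    have h' := congrArg ψ h
    rw [hψ, hψspow, hψspow, ← hk, add_mul, one_mul, add_comm, mul_comm n] at h'
    rw [hn, Nat.eq_of_mul_eq_mul_left (hψpos x) (Nat.add_right_cancel h')]
  refine ⟨fun x => ⟨ψ x, hψpos x⟩, fun x y hxy => ?_, fun x y => PNat.eq (hψ x y)⟩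
  have hxy : ψ x = ψ y := congrArg PNat.val hxy
  let γ : S → GrothendieckGroup (WithOne S) := fun x => GrothendieckGroup.of (x : WithOne S)
  have hγ : ∀ x z : S, γ z ^ ψ x = γ x ^ ψ z := by
    intro x z
    have h := congrArg GrothendieckGroup.of (hcomm x z)
    rw [map_mul, map_pow, map_pow, pow_succ'] at h
    exact mul_left_cancel h
  have hquot : γ x / γ y = 1 := by
    have hall : ∀ k ∈ AddSubgroup.closure (Set.range fun w => (ψ w : ℤ)),
        (γ x / γ y) ^ k = 1 := by
      intro k hk
      induction hk using AddSubgroup.closure_induction with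
      | mem k hk =>
        obtain ⟨w, rfl⟩ := hk
        simp only [zpow_natCast]
        rw [div_pow, hγ w x, hγ w y, hxy, div_self']
      | zero => exact zpow_zero _
      | add k l _ _ hk hl => rw [zpow_add, hk, hl, one_mul]
      | neg k _ hk => rw [zpow_neg, hk, inv_one]
    simpa using hall 1 (hψtop ▸ AddSubgroup.mem_top 1)
  obtain ⟨c, hc⟩ := (Localization.monoidOf (⊤ : Submonoid (WithOne S))).exists_of_eq
    (div_eq_one.1 hquot)
  have hdvd : ∀ z : S, ∃ n, (c : WithOne S) ∣ (z : WithOne S) ^ n := by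
    intro z
    refine WithOne.cases_on (c : WithOne S) ⟨0, one_dvd _⟩ fun c => ⟨ψ c + 1, ?_⟩
    rw [← hcomm z c]
    exact (dvd_pow_self _ (hψpos z).ne').mul_left _
  have hcancel : ∀ z : S, ∃ n,
      (z : WithOne S) ^ n * x = (z : WithOne S) ^ n * y := by
    intro z
    obtain ⟨n, u, hu⟩ := hdvd z
    exact ⟨n, by rw [hu, mul_right_comm, hc, mul_right_comm]⟩
  obtain ⟨m, hm⟩ := hcancel x
  obtain ⟨n, hn⟩ := hcancel y
  exact WithOne.coe_inj.1 (eq_of_pow_mul_eq_pow_mul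
    (fun _ _ => WithOne.eq_of_mul_self_eq_mul hsep) hm hn)
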